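/- Let q, z, x be complex numbers with q ≠ 0, z ≠ 0, and let n ≥ 0 and l be integers with 0 ≤ l ≤ n. Assume q^j ≠ 1 for all 1 ≤ j ≤ n, and x·q^k ≠ 1 for all 0 ≤ k ≤ n. Then ∑_{k=0}^{n} [n choose k]_q · (q/z;q)_k · (z·q^{-l};q)_{n-k} · z^k / (1 - x·q^k) = (q;q)_n · (x·z;q)_{n-l} · (z·q^{-l};q)_l / (x;q)_{n+1}. -/

import Mathlib

open Finset

/-- The q-Pochhammer symbol `(x;q)_N = ∏_{j=0}^{N-1} (1 - x q^j)`. -/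
noncomputable def qPoch (q x : ℂ) (N : ℕ) : ℂ := ∏ j ∈ Finset.range N, (1 - x * q ^ j)

/-- The Gaussian binomial coefficient `[n choose k]_q = (q;q)_n / ((q;q)_k (q;q)_{n-k})`. -/
noncomputable def qBinom (q : ℂ) (n k : ℕ) : ℂ := qPoch q q n / (qPoch q q k * qPoch q q (n - k))

theorem qPoch_add (q a : ℂ) (s t : ℕ) :
    qPoch q a (s + t) = qPoch q a s * qPoch q (a * q ^ s) t := by
  simp only [qPoch, Finset.prod_range_add, pow_add, mul_assoc]

theorem qPoch_succ (q a : ℂ) (m : ℕ) :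
    qPoch q a (m + 1) = qPoch q a m * (1 - a * q ^ m) :=
  Finset.prod_range_succ _ _

theorem qPoch_mul_inv_pow_succ {q : ℂ} (hq : q ≠ 0) (a : ℂ) (m : ℕ) :
    qPoch q (a * (q ^ (m + 1))⁻¹) (m + 1)
      = (1 - a * (q ^ (m + 1))⁻¹) * qPoch q (a * (q ^ m)⁻¹) m := by
  rw [add_comm m 1, qPoch_add]
  congr 1
  · simp [qPoch]
  · congr 1
    field_simp
    ring

theorem qPoch_div_mul_pow {q z : ℂ} (hq : q ≠ 0) (hz : z ≠ 0) (m : ℕ) :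
    qPoch q (q / z) m * z ^ m * qPoch q ((q ^ m)⁻¹) m
      = qPoch q (z * (q ^ m)⁻¹) m * qPoch q q m := by
  induction m with
  | zero => simp [qPoch]
  | succ m ih =>
    have h1 := qPoch_mul_inv_pow_succ hq 1 m
    simp only [one_mul] at h1
    rw [h1, qPoch_mul_inv_pow_succ hq z m, qPoch_succ, qPoch_succ q q]
    have h2 : (1 - q / z * q ^ m) * z * (1 - (q ^ (m + 1))⁻¹)
        = (1 - z * (q ^ (m + 1))⁻¹) * (1 - q * q ^ m) := by
      field_simp
      ring
    linear_combination (1 - q / z * q ^ m) * z * (1 - (q ^ (m + 1))⁻¹) * ih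
      + qPoch q (z * (q ^ m)⁻¹) m * qPoch q q m * h2

theorem qPoch_exchange {q : ℂ} (hq : q ≠ 0) (z : ℂ) {n l m : ℕ} (hl : l ≤ n) (hm : m ≤ n) :
    qPoch q (z * (q ^ m)⁻¹) m * qPoch q (z * (q ^ l)⁻¹) (n - m)
      = qPoch q (z * (q ^ m)⁻¹) (n - l) * qPoch q (z * (q ^ l)⁻¹) l := by
  rcases le_total (m + l) n with h | h
  · obtain ⟨r, rfl⟩ := Nat.exists_eq_add_of_le h
    rw [show m + l + r - m = l + r by omega, show m + l + r - l = m + r by omega,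
      qPoch_add, qPoch_add, inv_mul_cancel_right₀ (pow_ne_zero _ hq),
      inv_mul_cancel_right₀ (pow_ne_zero _ hq)]
    ring
  · obtain ⟨s, rfl⟩ := Nat.exists_eq_add_of_le hl
    obtain ⟨t, rfl⟩ := Nat.exists_eq_add_of_le (show s ≤ m by omega)
    obtain ⟨r, rfl⟩ := Nat.exists_eq_add_of_le (show t ≤ l by omega)
    rw [show t + r + s - (s + t) = r by omega, show t + r + s - (t + r) = s by omega,
      qPoch_add q _ s t, add_comm t r, qPoch_add q _ r t]
    have h1 : z * (q ^ (s + t))⁻¹ * q ^ s = z * (q ^ t)⁻¹ := by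
      field_simp
      ring
    have h2 : z * (q ^ (r + t))⁻¹ * q ^ r = z * (q ^ t)⁻¹ := by
      field_simp
      ring
    rw [h1, h2]
    ring

theorem prod_range_erase {M : Type*} [CommMonoid M] (f : ℕ → M) (m r : ℕ) :
    ∏ j ∈ (Finset.range (m + r + 1)).erase m, f j
      = (∏ j ∈ Finset.range m, f j) * ∏ j ∈ Finset.range r, f (m + 1 + j) := by
  induction r with
  | zero => simp [Finset.range_add_one]
  | succ r ih =>
    rw [← add_assoc m r 1, Finset.range_add_one (n := m + r + 1),
      Finset.erase_insert_of_ne (by omega), Finset.prod_insert (by simp), ih,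
      Finset.prod_range_succ, mul_comm, mul_assoc, add_right_comm m 1 r]

theorem prod_erase_inv_pow {q : ℂ} (hq : q ≠ 0) {n m : ℕ} (hm : m ≤ n) :
    ∏ j ∈ (Finset.range (n + 1)).erase m, (1 - (q ^ m)⁻¹ * q ^ j)
      = qPoch q ((q ^ m)⁻¹) m * qPoch q q (n - m) := by
  obtain ⟨r, rfl⟩ := Nat.exists_eq_add_of_le hm
  rw [prod_range_erase, Nat.add_sub_cancel_left]
  unfold qPoch
  congr 1
  refine Finset.prod_congr rfl fun j _ => ?_
  rw [pow_add, pow_succ]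
  field_simp

theorem qPoch_self_ne_zero {q : ℂ} {n k : ℕ} (hq1 : ∀ j : ℕ, 1 ≤ j → j ≤ n → q ^ j ≠ 1)
    (hk : k ≤ n) : qPoch q q k ≠ 0 := by
  refine Finset.prod_ne_zero_iff.mpr fun j hj => sub_ne_zero.mpr fun h => ?_
  rw [Finset.mem_range] at hj
  exact hq1 (j + 1) (by omega) (by omega) (by rw [pow_succ', ← h])

theorem inv_pow_injOn {q : ℂ} (hq : q ≠ 0) {n : ℕ}
    (hq1 : ∀ j : ℕ, 1 ≤ j → j ≤ n → q ^ j ≠ 1) :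
    Set.InjOn (fun m : ℕ => (q ^ m)⁻¹) (Finset.range (n + 1)) := by
  have key : ∀ a b : ℕ, b ≤ n → a ≤ b → q ^ a = q ^ b → a = b := by
    intro a b hb hab h
    obtain ⟨r, rfl⟩ := Nat.exists_eq_add_of_le hab
    rw [pow_add, left_eq_mul₀ (pow_ne_zero _ hq)] at h
    by_contra hr
    exact hq1 r (by omega) (by omega) h
  intro a ha b hb h
  simp only [Finset.coe_range, Set.mem_Iio] at ha hb
  have h' : q ^ a = q ^ b := inv_injective h
  rcases le_total a b with hab | hab
  · exact key a b (by omega) hab h'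
  · exact (key b a (by omega) hab h'.symm).symm

open Polynomial in
theorem degree_prod_one_sub_lt {s : Finset ℕ} {n : ℕ} (hs : s.card ≤ n) (a : ℕ → ℂ) (c : ℂ) :
    (C c * ∏ j ∈ s, (1 - X * C (a j))).degree < ((n + 1 : ℕ) : WithBot ℕ) := by
  refine (Polynomial.degree_le_of_natDegree_le (n := n) ?_).trans_lt
    (by exact_mod_cast n.lt_succ_self)
  refine (natDegree_C_mul_le _ _).trans ((natDegree_prod_le _ _).trans ?_)
  refine (Finset.sum_le_card_nsmul _ _ 1 fun j _ => ?_).trans (by simpa using hs)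
  compute_degree

open Polynomial in
/-- The identity with denominators cleared: both sides are polynomials in `x` of degree at most `n`
that agree at the `n + 1` points `q⁻ᵐ`. -/
theorem sum_mul_prod_erase {q z : ℂ} (hq : q ≠ 0) (hz : z ≠ 0) {n l : ℕ} (hl : l ≤ n)
    (hq1 : ∀ j : ℕ, 1 ≤ j → j ≤ n → q ^ j ≠ 1) (x : ℂ) :
    ∑ k ∈ Finset.range (n + 1),
        qBinom q n k * qPoch q (q / z) k * qPoch q (z * (q ^ l)⁻¹) (n - k) * z ^ k
          * ∏ j ∈ (Finset.range (n + 1)).erase k, (1 - x * q ^ j)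
      = qPoch q q n * qPoch q (x * z) (n - l) * qPoch q (z * (q ^ l)⁻¹) l := by
  let c : ℕ → ℂ := fun k =>
    qBinom q n k * qPoch q (q / z) k * qPoch q (z * (q ^ l)⁻¹) (n - k) * z ^ k
  let P : ℂ[X] := ∑ k ∈ Finset.range (n + 1),
    C (c k) * ∏ j ∈ (Finset.range (n + 1)).erase k, (1 - X * C (q ^ j))
  let Q : ℂ[X] := C (qPoch q q n * qPoch q (z * (q ^ l)⁻¹) l)
    * ∏ j ∈ Finset.range (n - l), (1 - X * C (z * q ^ j))
  have hP : ∀ y, P.eval y = ∑ k ∈ Finset.range (n + 1),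
      c k * ∏ j ∈ (Finset.range (n + 1)).erase k, (1 - y * q ^ j) := fun y => by
    simp [P, eval_finsetSum, eval_prod]
  have hQ : ∀ y, Q.eval y
      = qPoch q q n * qPoch q (y * z) (n - l) * qPoch q (z * (q ^ l)⁻¹) l := fun y => by
    simp only [Q, eval_mul, eval_C, eval_prod, eval_sub, eval_one, eval_X, qPoch, mul_assoc]
    ring
  have hPQ : P = Q := by
    refine Polynomial.eq_of_degrees_lt_of_eval_index_eq (Finset.range (n + 1))
      (inv_pow_injOn hq hq1) ?_ ?_ fun m hm => ?_
    · rw [Finset.card_range]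
      refine (degree_sum_le _ _).trans_lt ((Finset.sup_lt_iff (WithBot.bot_lt_coe _)).mpr
        fun k hk => degree_prod_one_sub_lt ?_ _ _)
      simp [Finset.card_erase_of_mem hk]
    · rw [Finset.card_range]
      exact degree_prod_one_sub_lt (by simp) _ _
    · have hmn : m ≤ n := by simpa [Nat.lt_succ_iff] using hm
      rw [hP, hQ, Finset.sum_eq_single_of_mem m hm fun k _ hkm => ?_, prod_erase_inv_pow hq hmn]
      · have h1 := qPoch_self_ne_zero hq1 hmn
        have h2 := qPoch_self_ne_zero hq1 (Nat.sub_le n m)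
        have hb : qBinom q n m * (qPoch q q m * qPoch q q (n - m)) = qPoch q q n :=
          div_mul_cancel₀ _ (mul_ne_zero h1 h2)
        rw [mul_comm _ z]
        linear_combination
          qBinom q n m * qPoch q (z * (q ^ l)⁻¹) (n - m) * qPoch q q (n - m)
              * qPoch_div_mul_pow hq hz m
            + qPoch q (z * (q ^ m)⁻¹) m * qPoch q (z * (q ^ l)⁻¹) (n - m) * hb
            + qPoch q q n * qPoch_exchange hq z hl hmn
      · rw [Finset.prod_eq_zero (Finset.mem_erase.mpr ⟨hkm.symm, hm⟩), mul_zero]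
        rw [inv_mul_cancel₀ (pow_ne_zero _ hq), sub_self]
  rw [← hQ, ← hPQ, hP]

theorem stmt_3 (q z x : ℂ) (hq : q ≠ 0) (hz : z ≠ 0) (n l : ℕ) (hl : l ≤ n)
    (hq1 : ∀ j : ℕ, 1 ≤ j → j ≤ n → q ^ j ≠ 1)
    (hx : ∀ k : ℕ, k ≤ n → x * q ^ k ≠ 1) :
    ∑ k ∈ Finset.range (n + 1),
        qBinom q n k * qPoch q (q / z) k * qPoch q (z * q ^ (-(l : ℤ))) (n - k) * z ^ k
          / (1 - x * q ^ k)
      = qPoch q q n * qPoch q (x * z) (n - l) * qPoch q (z * q ^ (-(l : ℤ))) l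
          / qPoch q x (n + 1) := by
  have hne : ∀ k ∈ Finset.range (n + 1), 1 - x * q ^ k ≠ 0 := fun k hk =>
    sub_ne_zero.mpr (hx k (by simpa [Nat.lt_succ_iff] using hk)).symm
  have hprod : qPoch q x (n + 1) ≠ 0 := Finset.prod_ne_zero_iff.mpr hne
  rw [zpow_neg, zpow_natCast, eq_div_iff hprod,
    ← sum_mul_prod_erase hq hz hl hq1 x, Finset.sum_mul]
  refine Finset.sum_congr rfl fun k hk => ?_
  rw [qPoch.eq_1 q x, ← Finset.mul_prod_erase _ _ hk, ← mul_assoc, div_mul_cancel₀ _ (hne k hk)]
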